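/- Let k₁ = 2 and 2 ≤ t ≤ min(k₂, d). For every minimal nonempty subset S ⊆ [2]×[k₂], the ideal I_S + I_{t+1}(X_{([2]×[k₂])∖S}) of ℂ[X] is prime, where X_{([2]×[k₂])∖S} is the submatrix of X obtained by removing the columns indexed by S. In particular, if d = t, then I_S is prime for every minimal nonempty S ⊆ [2]×[k₂]. -/

import Mathlib

noncomputable section

open MvPolynomial

namespace CI

/-- The column index set `[k₁] × [k₂]`. -/
abbrev Col (k₁ k₂ : ℕ) := Fin k₁ × Fin k₂

/-- The polynomial ring `ℂ[X]` in the entries of the `d × (k₁k₂)` matrix `X` of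
indeterminates `x_{i,(j,ℓ)}`. -/
abbrev MvP (d k₁ k₂ : ℕ) := MvPolynomial (Fin d × Col k₁ k₂) ℂ

/-- The `r × r` minor of `X` with rows `a` and columns `b`. -/
def minorPoly (d k₁ k₂ r : ℕ) (a : Fin r → Fin d) (b : Fin r → Col k₁ k₂) :
    MvP d k₁ k₂ :=
  (Matrix.of fun i j => (X (a i, b j) : MvP d k₁ k₂)).det

/-- `F_r(X_U)`: the set of all `r × r` minors of the submatrix `X_U`. -/
def minorSet (d k₁ k₂ r : ℕ) (U : Set (Col k₁ k₂)) : Set (MvP d k₁ k₂) :=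
  { f | ∃ a : Fin r → Fin d, ∃ b : Fin r → Col k₁ k₂,
      Function.Injective a ∧ Function.Injective b ∧ (∀ i, b i ∈ U) ∧
      f = minorPoly d k₁ k₂ r a b }

/-- `I_r(X_U)`: the ideal generated by the `r × r` minors of `X_U`. -/
def minorIdeal (d k₁ k₂ r : ℕ) (U : Set (Col k₁ k₂)) : Ideal (MvP d k₁ k₂) :=
  Ideal.span (minorSet d k₁ k₂ r U)

/-- The row slice `R_i = {i} × [k₂]`. -/
def rowSlice (k₁ k₂ : ℕ) (i : Fin k₁) : Set (Col k₁ k₂) := { p | p.1 = i }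

/-- The column slice `C_j = [k₁] × {j}`. -/
def colSlice (k₁ k₂ : ℕ) (j : Fin k₂) : Set (Col k₁ k₂) := { p | p.2 = j }

/-- The conditional independence ideal `𝓘_C = Σ_j I_2(X_{C_j}) + Σ_i I_t(X_{R_i})`. -/
def ciIdeal (d k₁ k₂ t : ℕ) : Ideal (MvP d k₁ k₂) :=
  (⨆ j : Fin k₂, minorIdeal d k₁ k₂ 2 (colSlice k₁ k₂ j)) ⊔
    ⨆ i : Fin k₁, minorIdeal d k₁ k₂ t (rowSlice k₁ k₂ i)

/-- `I_∅ = I_t(X) + Σ_j I_2(X_{C_j})`. -/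
def Iempty (d k₁ k₂ t : ℕ) : Ideal (MvP d k₁ k₂) :=
  minorIdeal d k₁ k₂ t Set.univ ⊔
    ⨆ j : Fin k₂, minorIdeal d k₁ k₂ 2 (colSlice k₁ k₂ j)

/-! ### The case `k₁ = 2`: the ideals `I_S` -/

/-- The column slice `C_j` does not meet `S`. -/
def colOK (k₂ : ℕ) (S : Set (Col 2 k₂)) (j : Fin k₂) : Prop := ∀ i : Fin 2, (i, j) ∉ S

/-- `𝒞(S)`: the union of all column slices not meeting `S`. -/
def CSet (k₂ : ℕ) (S : Set (Col 2 k₂)) : Set (Col 2 k₂) := { p | colOK k₂ S p.2 }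

/-- The condition `Z(1,S) ∖ Z(2,S) ≠ ∅` and `Z(2,S) ∖ Z(1,S) ≠ ∅` under which the
`(t-1)`-minors are included in `F_S`. -/
def tCond (k₂ : ℕ) (S : Set (Col 2 k₂)) : Prop :=
  (∃ ℓ, ((0 : Fin 2), ℓ) ∈ S ∧ ((1 : Fin 2), ℓ) ∉ S) ∧
  (∃ ℓ, ((1 : Fin 2), ℓ) ∈ S ∧ ((0 : Fin 2), ℓ) ∉ S)

/-- The generating set `F_S` of the ideal `I_S` (for `k₁ = 2`). -/
def FSset (d k₂ t : ℕ) (S : Set (Col 2 k₂)) : Set (MvP d 2 k₂) :=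
  minorSet d 2 k₂ 1 S ∪
  (⋃ j ∈ { j : Fin k₂ | colOK k₂ S j }, minorSet d 2 k₂ 2 (colSlice 2 k₂ j)) ∪
  (⋃ _ : tCond k₂ S, minorSet d 2 k₂ (t - 1) (CSet k₂ S)) ∪
  minorSet d 2 k₂ t ((rowSlice 2 k₂ 0 \ S) ∪ CSet k₂ S) ∪
  minorSet d 2 k₂ t ((rowSlice 2 k₂ 1 \ S) ∪ CSet k₂ S)

/-- The ideal `I_S ⊆ ℂ[X]` for `S ⊆ [2] × [k₂]`, generated by `F_S`. -/
def ISIdeal (d k₂ t : ℕ) (S : Set (Col 2 k₂)) : Ideal (MvP d 2 k₂) :=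
  Ideal.span (FSset d k₂ t S)

/-- `u = min(|R₁ ∩ S|, |R₂ ∩ S|)`, the first entry of the combinatorial type of `S`. -/
def uOf (k₂ : ℕ) (S : Set (Col 2 k₂)) : ℕ :=
  min ((rowSlice 2 k₂ 0 ∩ S).ncard) ((rowSlice 2 k₂ 1 ∩ S).ncard)

/-- `v = max(|R₁ ∩ S|, |R₂ ∩ S|)`, the second entry of the combinatorial type of `S`. -/
def vOf (k₂ : ℕ) (S : Set (Col 2 k₂)) : ℕ :=
  max ((rowSlice 2 k₂ 0 ∩ S).ncard) ((rowSlice 2 k₂ 1 ∩ S).ncard)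

/-- `S` contains no column slice. -/
def noColumn (k₂ : ℕ) (S : Set (Col 2 k₂)) : Prop :=
  ∀ j : Fin k₂, ¬ colSlice 2 k₂ j ⊆ S

/-- A subset `S ⊆ [2] × [k₂]` is minimal: `S = ∅`, or `S` contains no column slice,
its combinatorial type `(u,v)` satisfies `1 ≤ u ≤ v ≤ k₂ - t + 1`, and `u + v = k₂`
in case `t = 2`. -/
def minimalSubset (k₂ t : ℕ) (S : Set (Col 2 k₂)) : Prop :=
  S = ∅ ∨ (noColumn k₂ S ∧ 1 ≤ uOf k₂ S ∧ uOf k₂ S ≤ vOf k₂ S ∧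
    vOf k₂ S ≤ k₂ - t + 1 ∧ (t = 2 → uOf k₂ S + vOf k₂ S = k₂))

/-! ### Hypergraphs and their closure -/

/-- The hypergraph `H(S)` on `[k₁] × [k₂]`: its hyperedges are (1) the singletons of
elements of `S`; (2) the 2-subsets of a column slice disjoint from `S`; (3) the
`(t-1)`-subsets of `{i,j} × (NZ(i,S) ∩ NZ(j,S))` for distinct rows `i, j` with
`Z(i,S) ∖ Z(j,S) ≠ ∅` and `Z(j,S) ∖ Z(i,S) ≠ ∅`; (4) the `t`-subsets of a row slice
disjoint from `S`. -/
def HS (k₁ k₂ t : ℕ) (S : Set (Col k₁ k₂)) : Set (Finset (Col k₁ k₂)) :=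
  { e | (∃ p ∈ S, e = {p})
      ∨ (e.card = 2 ∧ (∃ j, ∀ p ∈ e, p.2 = j) ∧ ∀ p ∈ e, p ∉ S)
      ∨ (e.card = t - 1 ∧ ∃ i j : Fin k₁, i ≠ j ∧
           (∃ ℓ, (i, ℓ) ∈ S ∧ (j, ℓ) ∉ S) ∧ (∃ ℓ, (j, ℓ) ∈ S ∧ (i, ℓ) ∉ S) ∧
           ∀ p ∈ e, (p.1 = i ∨ p.1 = j) ∧ (i, p.2) ∉ S ∧ (j, p.2) ∉ S)
      ∨ (e.card = t ∧ (∃ i, ∀ p ∈ e, p.1 = i) ∧ ∀ p ∈ e, p ∉ S) }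

/-- The closure of a hypergraph: iterate the rule "if `{a,b}` and `e` (with `a ∈ e`)
are hyperedges, then add `(e ∖ {a}) ∪ {b}`". -/
inductive HClosure {k₁ k₂ : ℕ} (H : Set (Finset (Col k₁ k₂))) :
    Finset (Col k₁ k₂) → Prop
  | base {e : Finset (Col k₁ k₂)} : e ∈ H → HClosure H e
  | step {e : Finset (Col k₁ k₂)} (a b : Col k₁ k₂) :
      a ∈ e → HClosure H {a, b} → HClosure H e → HClosure H (insert b (e.erase a))

/-- The determinantal ideal of a hypergraph: it is generated by the minors `[A|B]`
with `A ⊆ [d]`, `B` a hyperedge, and `|A| = |B|`. -/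
def hypIdeal (d k₁ k₂ : ℕ) (H : Set (Finset (Col k₁ k₂))) : Ideal (MvP d k₁ k₂) :=
  Ideal.span { f | ∃ e ∈ H, ∃ a : Fin e.card → Fin d, ∃ b : Fin e.card → Col k₁ k₂,
      Function.Injective a ∧ Function.Injective b ∧ (∀ i, b i ∈ e) ∧
      f = minorPoly d k₁ k₂ e.card a b }

/-- The ideal `I_S` associated to the closure of the hypergraph `H(S)`. -/
def ISclosure (d k₁ k₂ t : ℕ) (S : Set (Col k₁ k₂)) : Ideal (MvP d k₁ k₂) :=
  hypIdeal d k₁ k₂ { e | HClosure (HS k₁ k₂ t S) e }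

/-! ### The lexicographic monomial order -/

/-- `varLT a b` means the variable `x_a` is *larger* than `x_b` in the variable order
`x_{1,(1,1)} > x_{2,(1,1)} > ⋯ > x_{d,(1,1)} > x_{1,(2,1)} > ⋯ > x_{d,(k₁,k₂)}`,
i.e. `(ℓ, j, i)` precedes `(ℓ', j', i')` lexicographically, where `a = (i, (j, ℓ))`. -/
def varLT (d k₁ k₂ : ℕ) (a b : Fin d × Col k₁ k₂) : Prop :=
  Prod.Lex (· < ·) (Prod.Lex (· < ·) (· < ·))
    (a.2.2, (a.2.1, a.1)) (b.2.2, (b.2.1, b.1))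

/-- `m ≺ m'` in the lexicographic monomial order determined by the variable order:
at the largest variable where the exponents differ, `m` has the smaller exponent. -/
def monLT (d k₁ k₂ : ℕ) (m m' : (Fin d × Col k₁ k₂) →₀ ℕ) : Prop :=
  ∃ v, (∀ w, varLT d k₁ k₂ w v → m w = m' w) ∧ m v < m' v

/-- `m` is the `≺`-leading monomial of `f`. -/
def IsLeadMon (d k₁ k₂ : ℕ) (f : MvP d k₁ k₂) (m : (Fin d × Col k₁ k₂) →₀ ℕ) : Prop :=
  m ∈ f.support ∧ ∀ m' ∈ f.support, m' = m ∨ monLT d k₁ k₂ m' m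

/-- `G` is a Gröbner basis of `I` with respect to the lexicographic order `≺`:
`G` is contained in `I` and for every nonzero `f ∈ I` there is a `g ∈ G` whose
`≺`-leading monomial divides the `≺`-leading monomial of `f`. -/
def IsGB (d k₁ k₂ : ℕ) (G : Set (MvP d k₁ k₂)) (I : Ideal (MvP d k₁ k₂)) : Prop :=
  G ⊆ (I : Set (MvP d k₁ k₂)) ∧ ∀ f ∈ I, f ≠ 0 →
    ∃ g ∈ G, ∃ mg, IsLeadMon d k₁ k₂ g mg ∧
      ∀ mf, IsLeadMon d k₁ k₂ f mf → ∀ x, mg x ≤ mf x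

/-! ### The matrix `D_A` -/

/-- For `A ∈ ℂ^{k₂ × (k₁-1)}`, the `k₂ × (k₁k₂)` matrix `D_A`: its row `r` has entry
`1` in the column indexed by `(1, r)`, entry `A r ℓ` in the column indexed by
`(1+ℓ, r)` for `ℓ ∈ [k₁-1]`, and zeros elsewhere. -/
def DMat (k₁ k₂ : ℕ) (A : Matrix (Fin k₂) (Fin (k₁ - 1)) ℂ) :
    Matrix (Fin k₂) (Col k₁ k₂) ℂ := fun r c =>
  if c.2 = r then
    (if _h : (c.1 : ℕ) = 0 then 1
     else A r ⟨(c.1 : ℕ) - 1, by have := c.1.isLt; omega⟩)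
  else 0

end CI

namespace CI

lemma exists_mem_between_finsets {A B : Finset ℝ} (h : ∀ a ∈ A, ∀ b ∈ B, a ≤ b) :
    ∃ x, (∀ a ∈ A, a ≤ x) ∧ ∀ b ∈ B, x ≤ b := by
  rcases A.eq_empty_or_nonempty with rfl | hA
  · rcases B.eq_empty_or_nonempty with rfl | hB
    · exact ⟨0, by simp, by simp⟩
    · exact ⟨B.min' hB, by simp, fun b hb => B.min'_le b hb⟩
  · exact ⟨A.max' hA, fun a ha => A.le_max' a ha, fun b hb => A.max'_le hA b fun a ha => h a ha b hb⟩

lemma exists_potentials {κ : Type*} (pos : κ → ℕ) (w : ℕ → κ → ℝ)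
    (hw : ∀ i i' j j', i ≤ i' → pos j ≤ pos j' → w i' j - w i j ≤ w i' j' - w i j')
    (K : Finset (ℕ × κ)) (hK : ∀ p ∈ K, ∀ q ∈ K, p.1 < q.1 → pos p.2 ≤ pos q.2)
    (d : ℕ) (hd : ∀ p ∈ K, p.1 < d) :
    ∃ (α : ℕ → ℝ) (γ : κ → ℝ), (∀ i < d, ∀ j, w i j ≤ α i + γ j) ∧
      ∀ p ∈ K, α p.1 + γ p.2 = w p.1 p.2 := by
  classical
  have hΔ : ∀ h : ℕ, ∃ Δ : ℝ, (∀ p ∈ K, p.1 ≤ h → w (h + 1) p.2 - w h p.2 ≤ Δ) ∧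
      ∀ p ∈ K, h < p.1 → Δ ≤ w (h + 1) p.2 - w h p.2 := by
    intro h
    obtain ⟨x, h1, h2⟩ := exists_mem_between_finsets
      (A := (K.filter fun p => p.1 ≤ h).image fun p => w (h + 1) p.2 - w h p.2)
      (B := (K.filter fun p => h < p.1).image fun p => w (h + 1) p.2 - w h p.2) (by
        simp only [Finset.mem_image, Finset.mem_filter]
        rintro _ ⟨p, ⟨hp, hph⟩, rfl⟩ _ ⟨q, ⟨hq, hqh⟩, rfl⟩
        exact hw _ _ _ _ (Nat.le_succ h) (hK p hp q hq (hph.trans_lt hqh)))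
    refine ⟨x, fun p hp hph => h1 _ ?_, fun p hp hph => h2 _ ?_⟩ <;>
      exact Finset.mem_image_of_mem _ (Finset.mem_filter.2 ⟨hp, hph⟩)
  choose Δ hΔ1 hΔ2 using hΔ
  let α : ℕ → ℝ := fun i => ∑ h ∈ Finset.range i, Δ h
  have hα : ∀ i, α (i + 1) = α i + Δ i := fun i => Finset.sum_range_succ _ _
  have key : ∀ p ∈ K, ∀ i, w i p.2 - α i ≤ w p.1 p.2 - α p.1 := by
    intro p hp i
    rcases le_total p.1 i with h | h
    · induction i, h using Nat.le_induction with
      | base => exact le_rfl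
      | succ n hn ih => linarith [hΔ1 n p hp hn, hα n]
    · induction h using Nat.decreasingInduction with
      | self => exact le_rfl
      | of_succ n hn ih => linarith [hΔ2 n p hp hn, hα n]
  have hγ : ∀ j : κ, ∃ g : ℝ, (∀ i < d, w i j - α i ≤ g) ∧
      ∀ p ∈ K, p.2 = j → g ≤ w p.1 j - α p.1 := by
    intro j
    obtain ⟨x, h1, h2⟩ := exists_mem_between_finsets
      (A := (Finset.range d).image fun i => w i j - α i)
      (B := (K.filter fun p => p.2 = j).image fun p => w p.1 j - α p.1) (by
        simp only [Finset.mem_image, Finset.mem_filter]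
        rintro _ ⟨i, _, rfl⟩ _ ⟨q, ⟨hq, rfl⟩, rfl⟩
        exact key q hq i)
    refine ⟨x, fun i hi => h1 _ ?_, fun p hp hpj => h2 _ ?_⟩
    · exact Finset.mem_image_of_mem _ (Finset.mem_range.2 hi)
    · exact Finset.mem_image_of_mem (fun p : ℕ × κ => w p.1 j - α p.1)
        (Finset.mem_filter.2 ⟨hp, hpj⟩)
  choose γ hγ1 hγ2 using hγ
  refine ⟨α, γ, fun i hi j => by linarith [hγ1 j i hi], fun p hp => ?_⟩
  linarith [hγ1 p.2 p.1 (hd p hp), hγ2 p.2 p hp rfl]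

lemma exists_coloring_of_chain_length_le {ι : Type*} (R : ι → ι → Prop)
    (htr : ∀ x y z, R x y → R y z → R x z) (n : ℕ) :
    ∀ T : Set ι, (∀ l : List ι, l.Pairwise R → (∀ x ∈ l, x ∈ T) → l.length ≤ n) →
      ∃ f : ι → ℕ, (∀ x ∈ T, f x < n) ∧ ∀ x ∈ T, ∀ y ∈ T, R x y → f x ≠ f y := by
  classical
  induction n with
  | zero =>
    intro T hT
    have hem : ∀ x, x ∉ T := fun x hx => by simpa using hT [x] (by simp) (by simpa using hx)
    exact ⟨fun _ => 0, fun x hx => (hem x hx).elim, fun x hx => (hem x hx).elim⟩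
  | succ n ih =>
    intro T hT
    obtain ⟨f, hf1, hf2⟩ := ih {x | x ∈ T ∧ ∃ y ∈ T, R y x} (by
      intro l hl hlT
      cases l with
      | nil => simp
      | cons a l =>
        obtain ⟨-, y, hy, hya⟩ := hlT a (by simp)
        have := hT (y :: a :: l) (by
          refine List.pairwise_cons.2 ⟨?_, hl⟩
          intro b hb
          rcases List.mem_cons.1 hb with rfl | hb
          · exact hya
          · exact htr _ _ _ hya (List.rel_of_pairwise_cons hl hb)) (by
          intro b hb
          rcases List.mem_cons.1 hb with rfl | hb
          · exact hy
          · exact (hlT b hb).1)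
        simpa using this)
    refine ⟨fun x => if ∃ y ∈ T, R y x then f x else n, fun x hx => ?_, fun x hx y hy hxy => ?_⟩
    · by_cases h : ∃ y ∈ T, R y x
      · simp only [h, if_true]
        exact (hf1 x ⟨hx, h⟩).trans (Nat.lt_succ_self n)
      · simp [h]
    · have h : ∃ z ∈ T, R z y := ⟨x, hx, hxy⟩
      simp only [h, if_true]
      by_cases h' : ∃ z ∈ T, R z x
      · simp only [h', if_true]
        exact hf2 x ⟨hx, h'⟩ y ⟨hy, h⟩ hxy
      · simp only [h', if_false]
        exact (hf1 y ⟨hy, h⟩).ne'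

lemma exists_coloring_of_graded_chain_bounds {ι : Type*} (R : ι → ι → Prop)
    (htr : ∀ x y z, R x y → R y z → R x z) (cls : ι → ℕ) (hcls : ∀ x y, R x y → cls y ≤ cls x)
    (hcls2 : ∀ x, cls x ≤ 2) (n : ℕ) (T : Set ι)
    (h1 : ∀ l : List ι, l.Pairwise R → (∀ x ∈ l, x ∈ T) → (∀ x ∈ l, cls x = 1) → l.length ≤ n)
    (h01 : ∀ l : List ι, l.Pairwise R → (∀ x ∈ l, x ∈ T) → (∀ x ∈ l, cls x ≤ 1) →
      l.length ≤ n + 1)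
    (h12 : ∀ l : List ι, l.Pairwise R → (∀ x ∈ l, x ∈ T) → (∀ x ∈ l, 1 ≤ cls x) →
      l.length ≤ n + 1)
    (h012 : ∀ l : List ι, l.Pairwise R → (∀ x ∈ l, x ∈ T) → l.length ≤ n + 2) :
    ∃ f : ι → ℕ, (∀ x ∈ T, f x < n ∨ (f x = n ∧ cls x = 0) ∨ (f x = n + 1 ∧ cls x = 2)) ∧
      ∀ x ∈ T, ∀ y ∈ T, R x y → f x ≠ f y := by
  classical
  let A : Set ι := {x | cls x = 0 ∧ ∀ y ∈ T, ¬ R x y}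
  let B : Set ι := {x | cls x = 2 ∧ ∀ y ∈ T, ¬ R y x}
  obtain ⟨f, hf1, hf2⟩ := exists_coloring_of_chain_length_le R htr n
    {x | x ∈ T ∧ x ∉ A ∧ x ∉ B} (by
      intro l hl hlT
      have hT : ∀ x ∈ l, x ∈ T := fun x hx => (hlT x hx).1
      -- extension of a chain to the left
      have hleft : (∀ x ∈ l, cls x ≤ 1) ∨
          ∃ y ∈ T, cls y = 2 ∧ ∀ x ∈ l, R y x := by
        cases l with
        | nil => left; simp
        | cons a l =>
          by_cases ha : cls a = 2
          · right
            obtain ⟨haT, -, haB⟩ := hlT a (by simp)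
            have : ∃ y ∈ T, R y a := by
              by_contra! hcon
              exact haB ⟨ha, hcon⟩
            obtain ⟨y, hy, hya⟩ := this
            refine ⟨y, hy, le_antisymm (hcls2 y) (ha ▸ hcls _ _ hya), fun x hx => ?_⟩
            rcases List.mem_cons.1 hx with rfl | hx
            · exact hya
            · exact htr _ _ _ hya (List.rel_of_pairwise_cons hl hx)
          · left
            have ha' := hcls2 a
            intro x hx
            rcases List.mem_cons.1 hx with rfl | hx
            · omega
            · have := hcls _ _ (List.rel_of_pairwise_cons hl hx)
              omega
      have hright : (∀ x ∈ l, 1 ≤ cls x) ∨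
          ∃ z ∈ T, cls z = 0 ∧ ∀ x ∈ l, R x z := by
        rcases List.eq_nil_or_concat' l with rfl | ⟨l', a, rfl⟩
        · left; simp
        · rw [List.pairwise_append] at hl
          by_cases ha : cls a = 0
          · right
            obtain ⟨haT, haA, -⟩ := hlT a (by simp)
            have : ∃ y ∈ T, R a y := by
              by_contra! hcon
              exact haA ⟨ha, hcon⟩
            obtain ⟨y, hy, hya⟩ := this
            have hya' := hcls _ _ hya
            refine ⟨y, hy, by omega, fun x hx => ?_⟩
            rcases List.mem_append.1 hx with hx | hx
            · exact htr _ _ _ (hl.2.2 x hx a (by simp)) hya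
            · rw [List.mem_singleton.1 hx]; exact hya
          · left
            intro x hx
            rcases List.mem_append.1 hx with hx | hx
            · have := hcls _ _ (hl.2.2 x hx a (by simp))
              omega
            · rw [List.mem_singleton.1 hx]; omega
      rcases hleft with hL | ⟨y, hyT, hy2, hy⟩ <;> rcases hright with hR | ⟨z, hzT, hz0, hz⟩
      · exact h1 l hl hT fun x hx => le_antisymm (hL x hx) (hR x hx)
      · have := h01 (l ++ [z]) (List.pairwise_append.2 ⟨hl, by simp, by simpa using hz⟩)
          (by
            intro x hx
            rcases List.mem_append.1 hx with hx | hx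
            · exact hT x hx
            · rw [List.mem_singleton.1 hx]; exact hzT)
          (by
            intro x hx
            rcases List.mem_append.1 hx with hx | hx
            · exact hL x hx
            · rw [List.mem_singleton.1 hx]; omega)
        simpa using this
      · have := h12 (y :: l) (List.pairwise_cons.2 ⟨hy, hl⟩)
          (by
            intro x hx
            rcases List.mem_cons.1 hx with rfl | hx
            · exact hyT
            · exact hT x hx)
          (by
            intro x hx
            rcases List.mem_cons.1 hx with rfl | hx
            · omega
            · exact hR x hx)
        simpa using this
      · by_cases hl0 : l = []
        · simp [hl0]
        · obtain ⟨a, ha⟩ := List.exists_mem_of_ne_nil l hl0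
          have := h012 (y :: (l ++ [z]))
            (List.pairwise_cons.2 ⟨by
              intro x hx
              rcases List.mem_append.1 hx with hx | hx
              · exact hy x hx
              · rw [List.mem_singleton.1 hx]; exact htr _ _ _ (hy a ha) (hz a ha),
              List.pairwise_append.2 ⟨hl, by simp, by simpa using hz⟩⟩)
            (by
              intro x hx
              rcases List.mem_cons.1 hx with rfl | hx
              · exact hyT
              · rcases List.mem_append.1 hx with hx | hx
                · exact hT x hx
                · rw [List.mem_singleton.1 hx]; exact hzT)
          simpa using this)
  refine ⟨fun x => if x ∈ A then n else if x ∈ B then n + 1 else f x, fun x hx => ?_,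
    fun x hx y hy hxy => ?_⟩
  · by_cases hA : x ∈ A
    · simp [hA, hA.1]
    · by_cases hB : x ∈ B
      · simp [hA, hB, hB.1]
      · simp [hA, hB, hf1 x ⟨hx, hA, hB⟩]
  · have hxA : x ∉ A := fun h => h.2 y hy hxy
    have hyB : y ∉ B := fun h => h.2 x hx hxy
    by_cases hyA : y ∈ A <;> by_cases hxB : x ∈ B
    · simp [hxA, hyA, hxB]
    · simpa [hxA, hyA, hxB] using (hf1 x ⟨hx, hxA, hxB⟩).ne
    · have := hf1 y ⟨hy, hyA, hyB⟩
      simp only [hxA, hyA, hxB, hyB, if_true, if_false]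
      omega
    · simpa [hxA, hyA, hxB, hyB] using hf2 x ⟨hx, hxA, hxB⟩ y ⟨hy, hyA, hyB⟩ hxy


lemma exists_transcendental_mem_Ioo : ∃ τ : ℝ, 0 < τ ∧ τ < 1 ∧ Transcendental ℤ τ := by
  have h : ({x : ℝ | IsAlgebraic ℤ x}).Countable := Algebraic.countable ℤ ℝ
  by_contra! hcon
  have hsub : Set.Ioo (0 : ℝ) 1 ⊆ {x : ℝ | IsAlgebraic ℤ x} := fun x hx =>
    not_not.1 (hcon x hx.1 hx.2)
  exact Cardinal.Real.Ioo_countable_iff.not.2 (by norm_num) (h.mono hsub)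

lemma exists_generic_weight : ∃ w : ℕ → ℕ → ℝ,
    (∀ i i' c c', i < i' → c < c' → w i' c + w i c' < w i c + w i' c') ∧
    Function.Injective (Finsupp.weight (R := ℕ) fun p : ℕ × ℕ => w p.1 p.2) := by
  obtain ⟨τ, h0, h1, hτ⟩ := exists_transcendental_mem_Ioo
  have hpos : ∀ n, 0 < τ ^ n := fun n => pow_pos h0 n
  have hle : ∀ n, τ ^ n ≤ 1 := fun n => pow_le_one₀ h0.le h1.le
  refine ⟨fun i c => 4 * (i * c) + τ ^ (Nat.pair i c + 1), fun i i' c c' hi hc => ?_,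
    fun m m' hm => ?_⟩
  · have hi' : (i : ℝ) + 1 ≤ i' := by exact_mod_cast hi
    have hc' : (c : ℝ) + 1 ≤ c' := by exact_mod_cast hc
    nlinarith [hle (Nat.pair i' c + 1), hle (Nat.pair i c' + 1), hpos (Nat.pair i c + 1),
      hpos (Nat.pair i' c' + 1),
      mul_le_mul (by linarith : (1 : ℝ) ≤ i' - i) (by linarith : (1 : ℝ) ≤ c' - c) zero_le_one
        (by linarith)]
  · let Q : (ℕ × ℕ →₀ ℕ) → Polynomial ℤ := fun m => m.sum fun p n =>
      n • (Polynomial.C (4 * (p.1 * p.2) : ℤ) + Polynomial.X ^ (Nat.pair p.1 p.2 + 1))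
    have hQ : ∀ m, Polynomial.aeval τ (Q m) = Finsupp.weight (R := ℕ)
        (fun p : ℕ × ℕ => 4 * ((p.1 : ℝ) * p.2) + τ ^ (Nat.pair p.1 p.2 + 1)) m := by
      intro m
      simp [Q, Finsupp.weight_apply, Finsupp.sum, map_sum, map_ofNat]
    have hcoeff : ∀ m p, (Q m).coeff (Nat.pair p.1 p.2 + 1) = m p := by
      intro m p
      simp only [Q, Finsupp.sum, Polynomial.finsetSum_coeff, Polynomial.coeff_smul,
        Polynomial.coeff_add, Polynomial.coeff_C, Polynomial.coeff_X_pow]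
      rw [Finset.sum_eq_single p]
      · simp
      · intro q _ hq
        have : Nat.pair p.1 p.2 ≠ Nat.pair q.1 q.2 := fun h => hq (by
          have := Nat.pair_eq_pair.1 h
          exact Prod.ext this.1.symm this.2.symm)
        simp [this]
      · intro hp
        simp [Finsupp.notMem_support_iff.1 hp]
    have hQQ : Q m = Q m' := by
      refine transcendental_iff_injective.1 hτ ?_
      rw [hQ, hQ]; exact hm
    ext p
    have := hcoeff m p
    rw [hQQ, hcoeff m' p] at this
    exact_mod_cast this.symm

/-- Reduction to normal form with respect to a generic weight. -/
lemma ideal_le_of_exists_initial_dvd {E : Type*} [Finite E] (W : (E →₀ ℕ) →+ ℝ)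
    (hW : Function.Injective W) (J K : Ideal (MvPolynomial E ℂ)) (hJK : J ≤ K)
    (h : ∀ f ∈ K, ∀ m ∈ f.support, (∀ m' ∈ f.support, m' ≠ m → W m < W m') →
      ∃ g ∈ J, ∃ μ ≤ m, g.coeff μ = 1 ∧
        ∀ μ' ∈ g.support, μ'.degree = μ.degree ∧ (μ' ≠ μ → W μ < W μ')) :
    K ≤ J := by
  classical
  intro f hf
  let 𝓜 : Finset (E →₀ ℕ) := (Finsupp.finite_of_degree_le (σ := E) f.totalDegree).toFinset
  have key : ∀ n : ℕ, ∀ f ∈ K, f.support ⊆ 𝓜 →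
      (𝓜.filter fun x => ∃ y ∈ f.support, W y ≤ W x).card ≤ n → f ∈ J := by
    intro n
    induction n with
    | zero =>
      intro f hf hsub hcard
      have : f = 0 := by
        by_contra hne
        obtain ⟨m, hm⟩ := Finset.nonempty_of_ne_empty (mt support_eq_empty.1 hne)
        have : m ∈ 𝓜.filter fun x => ∃ y ∈ f.support, W y ≤ W x :=
          Finset.mem_filter.2 ⟨hsub hm, m, hm, le_rfl⟩
        rw [Finset.card_eq_zero.1 (Nat.le_zero.1 hcard)] at this
        simp at this
      rw [this]; exact J.zero_mem
    | succ n ih =>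
      intro f hf hsub hcard
      by_cases hne : f = 0
      · rw [hne]; exact J.zero_mem
      obtain ⟨m, hm, hmin⟩ := f.support.exists_min_image W
        (Finset.nonempty_of_ne_empty (mt support_eq_empty.1 hne))
      have hmin' : ∀ m' ∈ f.support, m' ≠ m → W m < W m' := fun m' hm' hne =>
        lt_of_le_of_ne (hmin m' hm') fun h => hne (hW h).symm
      obtain ⟨g, hg, μ, hμ, hgμ, hgW⟩ := h f hf m hm hmin'
      set q : MvPolynomial E ℂ := monomial (m - μ) (f.coeff m) * g with hq
      have hqJ : q ∈ J := J.mul_mem_left _ hg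
      have hqm : q.coeff m = f.coeff m := by
        rw [hq, coeff_monomial_mul', if_pos tsub_le_self, tsub_tsub_cancel_of_le hμ, hgμ, mul_one]
      have hqsupp : ∀ x ∈ q.support, x.degree = m.degree ∧ (x ≠ m → W m < W x) := by
        intro x hx
        rw [mem_support_iff, hq, coeff_monomial_mul'] at hx
        split_ifs at hx with hle
        · have hx' : x - (m - μ) ∈ g.support := mem_support_iff.2 (right_ne_zero_of_mul hx)
          obtain ⟨hdeg, hlt⟩ := hgW _ hx'
          have e1 : x = (m - μ) + (x - (m - μ)) := (add_tsub_cancel_of_le hle).symm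
          have e2 : m = (m - μ) + μ := (tsub_add_cancel_of_le hμ).symm
          generalize x - (m - μ) = y at *
          generalize m - μ = z at *
          subst e1 e2
          simp only [map_add] at *
          exact ⟨by rw [hdeg], fun hne => by
            have := hlt fun hy => hne (by rw [hy])
            linarith⟩
        · exact absurd rfl hx
      have hmM : m.degree ≤ f.totalDegree := le_totalDegree hm
      have hfq : ∀ x ∈ (f - q).support, x ∈ 𝓜 ∧ W m < W x := by
        intro x hx
        have hxm : x ≠ m := by
          rintro rfl
          rw [mem_support_iff, coeff_sub, hqm, sub_self] at hx
          exact hx rfl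
        rcases Finset.mem_union.1 (support_sub E f q hx) with hx | hx
        · exact ⟨hsub hx, hmin' x hx hxm⟩
        · refine ⟨?_, (hqsupp x hx).2 hxm⟩
          have := hsub hm
          simp only [𝓜, Set.Finite.mem_toFinset, Set.mem_ofPred_eq] at this ⊢
          rw [(hqsupp x hx).1]; exact this
      have hmem : f - q ∈ J := by
        refine ih (f - q) (K.sub_mem hf (hJK hqJ)) (fun x hx => (hfq x hx).1) ?_
        refine Nat.le_of_lt_succ (lt_of_lt_of_le (Finset.card_lt_card ?_) hcard)
        refine (Finset.ssubset_iff_of_subset ?_).2 ⟨m, ?_, ?_⟩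
        · intro x hx
          obtain ⟨hx, y, hy, hyx⟩ := Finset.mem_filter.1 hx
          exact Finset.mem_filter.2 ⟨hx, m, hm, ((hfq y hy).2.trans_le hyx).le⟩
        · exact Finset.mem_filter.2 ⟨hsub hm, m, hm, le_rfl⟩
        · intro hx
          obtain ⟨hx, y, hy, hyx⟩ := Finset.mem_filter.1 hx
          exact absurd (hfq y hy).2 (not_lt.2 hyx)
      have := J.add_mem hmem hqJ
      rwa [sub_add_cancel] at this
  refine key _ f hf (fun m hm => ?_) le_rfl
  simp only [𝓜, Set.Finite.mem_toFinset, Set.mem_ofPred_eq]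
  exact le_totalDegree hm

lemma det_mul_eq_zero_of_card_lt {R : Type*} [CommRing R] [IsDomain R] {κ : Type*} [Fintype κ]
    {r : ℕ} (h : Fintype.card κ < r) (A : Matrix (Fin r) κ R) (B : Matrix κ (Fin r) R) :
    (A * B).det = 0 := by
  by_contra hne
  have h1 := Matrix.rank_mul_le_left A B
  have h2 := Matrix.rank_le_card_width A
  have h3 : (A * B).rank = r := by
    simpa using Matrix.rank_of_det_ne_zero hne
  omega

open HahnSeries in
lemma map_ne_zero_of_addVal {E : Type*} [Fintype E] (w : E → ℝ) (f : MvPolynomial E ℂ)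
    (m : E →₀ ℕ) (hm : m ∈ f.support)
    (hmin : ∀ m' ∈ f.support, m' ≠ m → Finsupp.weight w m < Finsupp.weight w m')
    (θ : MvPolynomial E ℂ →+* HahnSeries ℝ ℂ) (hθ : ∀ c, θ (MvPolynomial.C c) = HahnSeries.C c)
    (hx : ∀ e, (w e : WithTop ℝ) ≤ addVal ℝ ℂ (θ (X e)))
    (hxm : ∀ e ∈ m.support, addVal ℝ ℂ (θ (X e)) = (w e : WithTop ℝ)) :
    θ f ≠ 0 := by
  classical
  have hC : ∀ c : ℂ, c ≠ 0 → addVal ℝ ℂ (θ (MvPolynomial.C c)) = 0 := by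
    intro c hc
    rw [hθ, HahnSeries.C_apply, addVal_apply, HahnSeries.orderTop_single hc]; rfl
  obtain ⟨x, hxθ⟩ : ∃ x : E → HahnSeries ℝ ℂ, ∀ e, θ (X e) = x e := ⟨_, fun _ => rfl⟩
  simp only [hxθ] at hx hxm
  have hθf : θ f = ∑ m' ∈ f.support, θ (MvPolynomial.C (f.coeff m')) *
      m'.prod fun e n => x e ^ n := by
    have : θ = eval₂Hom (θ.comp MvPolynomial.C) x := ringHom_ext (by simp) (by simp [hxθ])
    conv_lhs => rw [this]
    rw [coe_eval₂Hom, eval₂_eq]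
    rfl
  have hprod : ∀ m' : E →₀ ℕ, addVal ℝ ℂ (m'.prod fun e n => x e ^ n) =
      ∑ e ∈ m'.support, m' e • addVal ℝ ℂ (x e) := by
    intro m'
    rw [Finsupp.prod]
    induction m'.support using Finset.induction_on with
    | empty => simp
    | insert a s ha ih => rw [Finset.prod_insert ha, Finset.sum_insert ha, AddValuation.map_mul,
        ih, AddValuation.map_pow]
  have hW : ∀ m' : E →₀ ℕ, ((Finsupp.weight w m' : ℝ) : WithTop ℝ) =
      ∑ e ∈ m'.support, m' e • (w e : WithTop ℝ) := by
    intro m'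
    rw [Finsupp.weight_apply, Finsupp.sum, WithTop.coe_sum]
    exact Finset.sum_congr rfl fun e _ => map_nsmul (WithTop.addHom : ℝ →+ WithTop ℝ) _ _
  have hge : ∀ m' : E →₀ ℕ, ((Finsupp.weight w m' : ℝ) : WithTop ℝ) ≤
      addVal ℝ ℂ (m'.prod fun e n => x e ^ n) := by
    intro m'
    rw [hW, hprod]
    exact Finset.sum_le_sum fun e _ => nsmul_le_nsmul_right (hx e) _
  have heq : addVal ℝ ℂ (m.prod fun e n => x e ^ n) = ((Finsupp.weight w m : ℝ) : WithTop ℝ) := by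
    rw [hW, hprod]
    exact Finset.sum_congr rfl fun e he => by rw [hxm e he]
  have hterm : ∀ m' ∈ f.support, addVal ℝ ℂ (θ (MvPolynomial.C (f.coeff m')) *
      m'.prod fun e n => x e ^ n) = addVal ℝ ℂ (m'.prod fun e n => x e ^ n) := fun m' hm' => by
    rw [AddValuation.map_mul, hC _ (mem_support_iff.1 hm'), zero_add]
  rw [hθf, ← Finset.add_sum_erase _ _ hm]
  have hlt := AddValuation.map_lt_sum (addVal ℝ ℂ) (s := f.support.erase m)
    (f := fun m' => θ (MvPolynomial.C (f.coeff m')) * m'.prod fun e n => x e ^ n)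
    (g := ((Finsupp.weight w m : ℝ) : WithTop ℝ)) WithTop.coe_ne_top (fun m' hm' => by
      obtain ⟨hne, hm'⟩ := Finset.mem_erase.1 hm'
      rw [hterm m' hm']
      exact (WithTop.coe_lt_coe.2 (hmin m' hm' hne)).trans_le (hge m'))
  have := AddValuation.map_add_eq_of_lt_left (addVal ℝ ℂ) ((heq ▸ hterm m hm).trans_lt hlt)
  intro h0
  have h1 := (this.symm.trans (congrArg (addVal ℝ ℂ) h0)).symm
  rw [AddValuation.map_zero, hterm m hm, heq] at h1
  exact WithTop.coe_ne_top h1.symm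


lemma sum_diag_lt_sum_perm {r : ℕ} (g : Fin r → Fin r → ℝ)
    (hg : ∀ i i' k k', i < i' → k < k' → g i k + g i' k' < g i' k + g i k')
    (σ : Equiv.Perm (Fin r)) (hσ : σ ≠ 1) : ∑ k, g k k < ∑ k, g (σ k) k := by
  classical
  have step : ∀ τ : Equiv.Perm (Fin r), τ ≠ 1 → ∃ τ' : Equiv.Perm (Fin r),
      ∑ k, g (τ' k) k < ∑ k, g (τ k) k := by
    intro τ hτ
    obtain ⟨k, k', hk, hinv⟩ : ∃ k k', k < k' ∧ τ k' < τ k := by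
      by_contra! hcon
      have hmono : StrictMono τ := fun k k' hk =>
        lt_of_le_of_ne (hcon k k' hk) fun h => hk.ne (τ.injective h)
      have := (hmono.range_inj (strictMono_id (α := Fin r))).1
        (by rw [τ.surjective.range_eq, Set.range_id])
      exact hτ (Equiv.ext fun x => congrFun this x)
    refine ⟨τ * Equiv.swap k k', ?_⟩
    have hk' : k' ∈ Finset.univ.erase k := Finset.mem_erase.2 ⟨hk.ne', Finset.mem_univ _⟩
    rw [← Finset.add_sum_erase _ _ (Finset.mem_univ k), ← Finset.add_sum_erase _ _ hk',
      ← Finset.add_sum_erase _ (fun k => g (τ k) k) (Finset.mem_univ k),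
      ← Finset.add_sum_erase _ (fun k => g (τ k) k) hk']
    have hrest : ∑ x ∈ (Finset.univ.erase k).erase k', g ((τ * Equiv.swap k k') x) x =
        ∑ x ∈ (Finset.univ.erase k).erase k', g (τ x) x := by
      refine Finset.sum_congr rfl fun x hx => ?_
      simp only [Finset.mem_erase] at hx
      rw [Equiv.Perm.mul_apply, Equiv.swap_apply_of_ne_of_ne hx.2.1 hx.1]
    rw [hrest]
    simp only [Equiv.Perm.mul_apply, Equiv.swap_apply_left, Equiv.swap_apply_right]
    linarith [hg _ _ _ _ hinv hk]
  obtain ⟨τ, -, hτ⟩ := Finset.exists_min_image (Finset.univ : Finset (Equiv.Perm (Fin r)))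
    (fun τ => ∑ k, g (τ k) k) ⟨1, Finset.mem_univ _⟩
  have h1 : τ = 1 := by
    by_contra hne
    obtain ⟨τ', h'⟩ := step τ hne
    exact absurd h' (not_lt.2 (hτ τ' (Finset.mem_univ _)))
  obtain ⟨σ', hlt⟩ := step σ hσ
  subst h1
  exact (hτ σ' (Finset.mem_univ _)).trans_lt hlt

/-- The leading monomial of a minor for a strictly Monge weight is its antidiagonal. -/
lemma exists_minor_initial_le {d k₂ : ℕ} (w : ℕ → ℕ → ℝ)
    (hw : ∀ i i' c c', i < i' → c < c' → w i' c + w i c' < w i c + w i' c')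
    (num : Col 2 k₂ → ℕ) {r : ℕ} (a : Fin r → Fin d) (b : Fin r → Col 2 k₂)
    (ha : StrictMono a) (hb : StrictAnti (num ∘ b)) (U : Set (Col 2 k₂)) (hU : ∀ k, b k ∈ U)
    (m : Fin d × Col 2 k₂ →₀ ℕ) (hm : ∀ k, (a k, b k) ∈ m.support) :
    ∃ g ∈ minorSet d 2 k₂ r U, ∃ μ ≤ m, g.coeff μ = 1 ∧
      ∀ μ' ∈ g.support, μ'.degree = μ.degree ∧ (μ' ≠ μ →
        Finsupp.weight (fun e : Fin d × Col 2 k₂ => w e.1 (num e.2)) μ <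
          Finsupp.weight (fun e : Fin d × Col 2 k₂ => w e.1 (num e.2)) μ') := by
  classical
  let mon : Equiv.Perm (Fin r) → (Fin d × Col 2 k₂ →₀ ℕ) := fun σ =>
    ∑ k, Finsupp.single (a (σ k), b k) 1
  have hW : ∀ σ, Finsupp.weight (fun e : Fin d × Col 2 k₂ => w e.1 (num e.2)) (mon σ) =
      ∑ k, w (a (σ k)) (num (b k)) := by
    intro σ
    simp [mon, map_sum, Finsupp.weight_single]
  have hlt : ∀ σ, σ ≠ 1 →
      Finsupp.weight (fun e : Fin d × Col 2 k₂ => w e.1 (num e.2)) (mon 1) <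
        Finsupp.weight (fun e : Fin d × Col 2 k₂ => w e.1 (num e.2)) (mon σ) := by
    intro σ hσ
    rw [hW, hW]
    refine sum_diag_lt_sum_perm (fun i k => w (a i) (num (b k))) (fun i i' k k' hi hk => ?_) σ hσ
    have := hw (a i) (a i') (num (b k')) (num (b k)) (ha hi) (hb hk)
    linarith
  have hdeg : ∀ σ, (mon σ).degree = r := by
    intro σ
    simp [mon, map_sum]
  have hminor : minorPoly d 2 k₂ r a b =
      ∑ σ : Equiv.Perm (Fin r), monomial (mon σ) ((Equiv.Perm.sign σ : ℤ) : ℂ) := by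
    rw [minorPoly, Matrix.det_apply]
    refine Finset.sum_congr rfl fun σ _ => ?_
    have : ∏ k, (X (a (σ k), b k) : MvP d 2 k₂) = monomial (mon σ) 1 := by
      rw [show monomial (mon σ) (1 : ℂ) = ∏ k, monomial (Finsupp.single (a (σ k), b k) 1) 1 from
        (monomial_sum_one _ _)]
      rfl
    simp only [Matrix.of_apply]
    rw [this, Units.smul_def, ← Int.cast_smul_eq_zsmul ℂ, smul_monomial, smul_eq_mul, mul_one]
  refine ⟨minorPoly d 2 k₂ r a b,
    ⟨a, b, ha.injective, hb.injective.of_comp, hU, rfl⟩, mon 1, ?_, ?_, ?_⟩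
  · intro e
    simp only [mon, Finsupp.finsetSum_apply, Equiv.Perm.one_apply, Finsupp.single_apply]
    by_cases he : ∃ k, (a k, b k) = e
    · obtain ⟨k, rfl⟩ := he
      rw [Finset.sum_eq_single k]
      · simpa [Nat.one_le_iff_ne_zero] using hm k
      · intro k' _ hk'
        rw [if_neg]
        exact fun h => hk' (ha.injective (Prod.ext_iff.1 h).1)
      · simp
    · push Not at he
      simp [he]
  · rw [hminor, coeff_sum, Finset.sum_eq_single 1]
    · simp
    · intro σ _ hσ
      rw [coeff_monomial, if_neg]
      intro h
      exact (hlt σ hσ).ne' (by rw [h])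
    · simp
  · intro μ' hμ'
    rw [hminor] at hμ'
    obtain ⟨σ, -, hσ⟩ := Finset.mem_biUnion.1 (support_sum hμ')
    have : μ' = mon σ := by simpa using support_monomial_subset hσ
    subst this
    exact ⟨by rw [hdeg, hdeg], fun h => hlt σ (fun h1 => h (by rw [h1]))⟩

open Classical in
/-- The class of an index `ℓ`: `0` if `(2,ℓ) ∈ S`, otherwise `2` if `(1,ℓ) ∈ S`, and `1` if the
column slice of `ℓ` does not meet `S`. -/
def cls {k₂ : ℕ} (S : Set (Col 2 k₂)) (ℓ : Fin k₂) : ℕ :=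
  if (1, ℓ) ∈ S then 0 else if (0, ℓ) ∈ S then 2 else 1

lemma cls_le_two {k₂ : ℕ} (S : Set (Col 2 k₂)) (ℓ : Fin k₂) : cls S ℓ ≤ 2 := by
  unfold cls; split_ifs <;> omega

lemma cls_eq_one_iff {k₂ : ℕ} (S : Set (Col 2 k₂)) (ℓ : Fin k₂) : cls S ℓ = 1 ↔ colOK k₂ S ℓ := by
  unfold cls colOK
  rw [Fin.forall_fin_two]
  split_ifs <;> simp [*]

lemma one_mem_of_cls_eq_zero {k₂ : ℕ} {S : Set (Col 2 k₂)} {ℓ : Fin k₂} (h : cls S ℓ = 0) :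
    (1, ℓ) ∈ S := by
  unfold cls at h
  split_ifs at h
  assumption

lemma zero_mem_of_cls_eq_two {k₂ : ℕ} {S : Set (Col 2 k₂)} {ℓ : Fin k₂} (h : cls S ℓ = 2) :
    (0, ℓ) ∈ S := by
  unfold cls at h
  split_ifs at h
  · assumption
  · omega

/-- The position of an index `ℓ` after sorting by class. -/
def pos {k₂ : ℕ} (S : Set (Col 2 k₂)) (ℓ : Fin k₂) : ℕ := cls S ℓ * k₂ + ℓ

lemma pos_injective {k₂ : ℕ} (S : Set (Col 2 k₂)) : Function.Injective (pos S) := by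
  intro ℓ ℓ' h
  unfold pos at h
  have := congrArg (· % k₂) h
  simp only [Nat.mul_add_mod_self_right, Nat.mod_eq_of_lt ℓ.2, Nat.mod_eq_of_lt ℓ'.2] at this
  exact Fin.ext this

lemma cls_le_of_pos_lt {k₂ : ℕ} {S : Set (Col 2 k₂)} {ℓ ℓ' : Fin k₂} (h : pos S ℓ < pos S ℓ') :
    cls S ℓ ≤ cls S ℓ' := by
  unfold pos at h
  by_contra! hlt
  have h1 := Nat.mul_le_mul_right k₂ (Nat.succ_le_of_lt hlt)
  rw [Nat.succ_mul] at h1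
  have := ℓ'.2
  omega

/-- The position of a column after sorting by class. -/
def colNum {k₂ : ℕ} (S : Set (Col 2 k₂)) (c : Col 2 k₂) : ℕ := 2 * pos S c.2 + c.1

lemma colNum_injective {k₂ : ℕ} (S : Set (Col 2 k₂)) : Function.Injective (colNum S) := by
  rintro ⟨s, ℓ⟩ ⟨s', ℓ'⟩ h
  change 2 * pos S ℓ + (s : ℕ) = 2 * pos S ℓ' + (s' : ℕ) at h
  have h1 := s.2
  have h2 := s'.2
  exact Prod.ext (Fin.ext (show (s : ℕ) = s' by omega))
    (pos_injective S (show pos S ℓ = pos S ℓ' by omega))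

/-- The indices `k` of the inner factors contributing to the columns of index `ℓ` in the
parametrization of the variety of `I_S + I_{n+3}`. -/
def Allowed {k₂ : ℕ} (n : ℕ) (S : Set (Col 2 k₂)) (k : ℕ) (ℓ : Fin k₂) : Prop :=
  k < n ∨ (k = n ∧ cls S ℓ = 0) ∨ (k = n + 1 ∧ cls S ℓ = 2)

open Classical in
/-- The point of the variety of `I_S + I_{n+3}` with parameters `y`, `z`, `b`. -/
def paramPoint {R : Type*} [CommRing R] {d k₂ : ℕ} (n : ℕ) (S : Set (Col 2 k₂))
    (y : Fin d → ℕ → R) (z : ℕ → Fin k₂ → R) (b : Col 2 k₂ → R) (e : Fin d × Col 2 k₂) : R :=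
  if e.2 ∈ S then 0 else b e.2 * ∑ k ∈ (Finset.range (n + 2)).filter (Allowed n S · e.2.2),
    y e.1 k * z k e.2.2

/-- The ideal `I_S + I_{t+1}` of the main theorem. -/
abbrev sumIdeal (d k₂ t : ℕ) (S : Set (Col 2 k₂)) : Ideal (MvP d 2 k₂) :=
  ISIdeal d k₂ t S ⊔ minorIdeal d 2 k₂ (t + 1) Sᶜ

lemma map_minorPoly {R : Type*} [CommRing R] {d k₂ : ℕ} (θ : MvP d 2 k₂ →+* R) {r : ℕ}
    (a : Fin r → Fin d) (c : Fin r → Col 2 k₂) :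
    θ (minorPoly d 2 k₂ r a c) = (Matrix.of fun i j => θ (X (a i, c j))).det := by
  rw [minorPoly, RingHom.map_det]
  rfl

section Vanishing

variable {R : Type*} [CommRing R] [IsDomain R] {d k₂ n : ℕ} {S : Set (Col 2 k₂)}
  {y : Fin d → ℕ → R} {z : ℕ → Fin k₂ → R} {b : Col 2 k₂ → R}

lemma map_eq_zero_of_mem_minorSet (θ : MvP d 2 k₂ →+* R)
    (hθ : ∀ e, θ (X e) = paramPoint n S y z b e) {r : ℕ} {U : Set (Col 2 k₂)} (T : Finset ℕ)
    (hT : T.card < r) (hU : ∀ c ∈ U, c ∉ S → ∀ k, Allowed n S k c.2 → k ∈ T)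
    (g : MvP d 2 k₂) (hg : g ∈ minorSet d 2 k₂ r U) : θ g = 0 := by
  classical
  obtain ⟨a, c, -, -, hc, rfl⟩ := hg
  rw [map_minorPoly]
  rw [← det_mul_eq_zero_of_card_lt (κ := T) (by simpa using hT)
    (Matrix.of fun i k => y (a i) k) (Matrix.of fun k j => if c j ∈ S then 0 else
      if (k : ℕ) ∈ Finset.range (n + 2) ∧ Allowed n S k (c j).2 then b (c j) * z k (c j).2 else 0)]
  congr 1
  ext i j
  rw [Matrix.of_apply, hθ, paramPoint, Matrix.mul_apply]
  simp only [Matrix.of_apply]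
  by_cases hS : c j ∈ S
  · simp [hS]
  · simp only [hS, if_false]
    rw [Finset.sum_coe_sort T (fun k => y (a i) k * if k ∈ Finset.range (n + 2) ∧
      Allowed n S k (c j).2 then b (c j) * z k (c j).2 else 0), Finset.mul_sum]
    simp only [mul_ite, mul_zero]
    rw [← Finset.sum_filter]
    refine Finset.sum_congr ?_ fun k _ => by ring
    ext k
    simp only [Finset.mem_filter]
    exact ⟨fun h => ⟨hU _ (hc j) hS k h.2, h⟩, fun h => h.2⟩

lemma map_eq_zero_of_mem_minorSet_colSlice (θ : MvP d 2 k₂ →+* R)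
    (hθ : ∀ e, θ (X e) = paramPoint n S y z b e) (ℓ : Fin k₂)
    (g : MvP d 2 k₂) (hg : g ∈ minorSet d 2 k₂ 2 (colSlice 2 k₂ ℓ)) : θ g = 0 := by
  classical
  obtain ⟨a, c, -, -, hc, rfl⟩ := hg
  rw [map_minorPoly]
  rw [← det_mul_eq_zero_of_card_lt (κ := Unit) (by simp)
    (Matrix.of fun i _ => ∑ k ∈ (Finset.range (n + 2)).filter (Allowed n S · ℓ), y (a i) k * z k ℓ)
    (Matrix.of fun _ j => if c j ∈ S then 0 else b (c j))]
  congr 1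
  ext i j
  have hj : (c j).2 = ℓ := hc j
  rw [Matrix.of_apply, hθ, paramPoint, Matrix.mul_apply]
  simp only [Matrix.of_apply]
  simp only [hj, Finset.univ_unique, Finset.sum_singleton]
  split_ifs
  · simp
  · ring

lemma map_eq_zero_of_mem_sumIdeal (θ : MvP d 2 k₂ →+* R)
    (hθ : ∀ e, θ (X e) = paramPoint n S y z b e) :
    sumIdeal d k₂ (n + 2) S ≤ RingHom.ker θ := by
  have hcls : ∀ c : Col 2 k₂, c ∈ CSet k₂ S → cls S c.2 = 1 := fun c hc =>
    (cls_eq_one_iff S c.2).2 hc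
  refine sup_le (Ideal.span_le.2 ?_) (Ideal.span_le.2 ?_)
  · rintro g ((((hg | hg) | hg) | hg) | hg)
    · exact map_eq_zero_of_mem_minorSet θ hθ ∅ (by simp) (fun c hc hcS => absurd hc hcS) g hg
    · simp only [Set.mem_iUnion] at hg
      obtain ⟨ℓ, -, hg⟩ := hg
      exact map_eq_zero_of_mem_minorSet_colSlice θ hθ ℓ g hg
    · simp only [Set.mem_iUnion] at hg
      obtain ⟨-, hg⟩ := hg
      refine map_eq_zero_of_mem_minorSet θ hθ (Finset.range n) (by simp) (fun c hc _ k hk => ?_)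
        g hg
      have := hcls c hc
      unfold Allowed at hk
      exact Finset.mem_range.2 (by omega)
    · refine map_eq_zero_of_mem_minorSet θ hθ (Finset.range (n + 1)) (by simp)
        (fun c hc hcS k hk => ?_) g hg
      have h2 : cls S c.2 ≠ 2 := by
        rcases hc with hc | hc
        · obtain ⟨s, ℓ⟩ := c
          obtain rfl : s = 0 := hc.1
          exact fun h => hcS (zero_mem_of_cls_eq_two h)
        · rw [hcls c hc]; omega
      unfold Allowed at hk
      exact Finset.mem_range.2 (by omega)
    · refine map_eq_zero_of_mem_minorSet θ hθ (insert (n + 1) (Finset.range n)) (by simp)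
        (fun c hc hcS k hk => ?_) g hg
      have h2 : cls S c.2 ≠ 0 := by
        rcases hc with hc | hc
        · obtain ⟨s, ℓ⟩ := c
          obtain rfl : s = 1 := hc.1
          exact fun h => hcS (one_mem_of_cls_eq_zero h)
        · rw [hcls c hc]; omega
      unfold Allowed at hk
      simp only [Finset.mem_insert, Finset.mem_range]
      omega
  · intro g hg
    refine map_eq_zero_of_mem_minorSet θ hθ (Finset.range (n + 2)) (by simp)
      (fun c hc hcS k hk => ?_) g hg
    unfold Allowed at hk
    exact Finset.mem_range.2 (by omega)

end Vanishing

open HahnSeries in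
lemma exists_paramPoint_addVal {d k₂ n : ℕ} {S : Set (Col 2 k₂)} (w : ℕ → ℕ → ℝ)
    (hw : ∀ i i' c c', i < i' → c < c' → w i' c + w i c' < w i c + w i' c')
    (s : Finset (Fin d × Col 2 k₂)) (hs : ∀ e ∈ s, e.2 ∉ S)
    (hcol : ∀ i i' ℓ, (i, (0, ℓ)) ∈ s → (i', (1, ℓ)) ∈ s → i ≤ i')
    (f : Fin d × Fin k₂ → ℕ) (hf : ∀ e ∈ s, Allowed n S (f (e.1, e.2.2)) e.2.2)
    (hf' : ∀ e ∈ s, ∀ e' ∈ s, e.1 < e'.1 → pos S e'.2.2 < pos S e.2.2 →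
      f (e.1, e.2.2) ≠ f (e'.1, e'.2.2)) :
    ∃ (y : Fin d → ℕ → HahnSeries ℝ ℂ) (z : ℕ → Fin k₂ → HahnSeries ℝ ℂ)
      (b : Col 2 k₂ → HahnSeries ℝ ℂ),
      (∀ e, (w e.1 (colNum S e.2) : WithTop ℝ) ≤ addVal ℝ ℂ (paramPoint n S y z b e)) ∧
      ∀ e ∈ s, addVal ℝ ℂ (paramPoint n S y z b e) = (w e.1 (colNum S e.2) : WithTop ℝ) := by
  classical
  have hD : ∀ ℓ, ∃ D : ℝ,
      (∀ i : Fin d, (i, (0, ℓ)) ∈ s → w i (2 * pos S ℓ + 1) - w i (2 * pos S ℓ) ≤ D) ∧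
      ∀ i : Fin d, (i, (1, ℓ)) ∈ s → D ≤ w i (2 * pos S ℓ + 1) - w i (2 * pos S ℓ) := by
    intro ℓ
    obtain ⟨D, h1, h2⟩ := exists_mem_between_finsets
      (A := (Finset.univ.filter fun i : Fin d => (i, ((0 : Fin 2), ℓ)) ∈ s).image fun i : Fin d =>
        w i (2 * pos S ℓ + 1) - w i (2 * pos S ℓ))
      (B := (Finset.univ.filter fun i : Fin d => (i, ((1 : Fin 2), ℓ)) ∈ s).image fun i : Fin d =>
        w i (2 * pos S ℓ + 1) - w i (2 * pos S ℓ)) (by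
        simp only [Finset.mem_image, Finset.mem_filter, Finset.mem_univ, true_and]
        rintro _ ⟨i, hi, rfl⟩ _ ⟨i', hi', rfl⟩
        rcases (hcol i i' ℓ hi hi').eq_or_lt with rfl | hlt
        · exact le_rfl
        · have := hw i i' (2 * pos S ℓ) (2 * pos S ℓ + 1) hlt (Nat.lt_succ_self _)
          linarith)
    exact ⟨D, fun i hi => h1 _ (Finset.mem_image_of_mem _ (by simpa using hi)),
      fun i hi => h2 _ (Finset.mem_image_of_mem _ (by simpa using hi))⟩
  choose D hD0 hD1 using hD
  let w' : ℕ → Fin k₂ → ℝ := fun i ℓ =>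
    max (w i (2 * pos S ℓ)) (w i (2 * pos S ℓ + 1) - D ℓ)
  have hw' : ∀ i i' j j', i ≤ i' → pos S j ≤ pos S j' →
      w' i' j - w' i j ≤ w' i' j' - w' i j' := by
    intro i i' j j' hi hj
    rcases hi.eq_or_lt with rfl | hi
    · simp
    rcases hj.eq_or_lt with hj | hj
    · rw [pos_injective S hj]
    have m1 := hw i i' (2 * pos S j) (2 * pos S j + 1) hi (by omega)
    have m2 := hw i i' (2 * pos S j + 1) (2 * pos S j') hi (by omega)
    have m3 := hw i i' (2 * pos S j') (2 * pos S j' + 1) hi (by omega)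
    have u1 : w' i' j ≤ w' i j + (w i' (2 * pos S j + 1) - w i (2 * pos S j + 1)) := by
      refine max_le ?_ ?_
      · have : w i (2 * pos S j) ≤ w' i j := le_max_left _ _
        linarith
      · have : w i (2 * pos S j + 1) - D j ≤ w' i j := le_max_right _ _
        linarith
    have u2 : w' i j' ≤ w' i' j' - (w i' (2 * pos S j') - w i (2 * pos S j')) := by
      refine max_le ?_ ?_
      · have : w i' (2 * pos S j') ≤ w' i' j' := le_max_left _ _
        linarith
      · have : w i' (2 * pos S j' + 1) - D j' ≤ w' i' j' := le_max_right _ _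
        linarith
    linarith
  have hle : ∀ (i : Fin d) (c : Col 2 k₂),
      w i (colNum S c) ≤ ((c.1 : ℕ) : ℝ) * D c.2 + w' i c.2 := by
    rintro i ⟨c, ℓ⟩
    fin_cases c
    · have : w i (2 * pos S ℓ) ≤ w' i ℓ := le_max_left _ _
      simpa [colNum] using this
    · have : w i (2 * pos S ℓ + 1) - D ℓ ≤ w' i ℓ := le_max_right _ _
      simp only [colNum, Nat.cast_one, one_mul]
      linarith
  have heq : ∀ e ∈ s, ((e.2.1 : ℕ) : ℝ) * D e.2.2 + w' e.1 e.2.2 = w e.1 (colNum S e.2) := by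
    rintro ⟨i, ⟨c, ℓ⟩⟩ he
    fin_cases c
    · have : w' i ℓ = w i (2 * pos S ℓ) := max_eq_left (by linarith [hD0 ℓ i he])
      simpa [colNum] using this
    · have : w' i ℓ = w i (2 * pos S ℓ + 1) - D ℓ := max_eq_right (by linarith [hD1 ℓ i he])
      simp only [colNum, Nat.cast_one, one_mul]
      linarith
  let K : ℕ → Finset (ℕ × Fin k₂) := fun k =>
    (s.filter fun e => f (e.1, e.2.2) = k).image fun e => ((e.1 : ℕ), e.2.2)
  have hpot : ∀ k, ∃ (α : ℕ → ℝ) (γ : Fin k₂ → ℝ), (∀ i < d, ∀ j, w' i j ≤ α i + γ j) ∧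
      ∀ p ∈ K k, α p.1 + γ p.2 = w' p.1 p.2 := by
    intro k
    refine exists_potentials (pos S) w' hw' (K k) ?_ d ?_
    · simp only [K, Finset.mem_image, Finset.mem_filter]
      rintro _ ⟨e, ⟨he, rfl⟩, rfl⟩ _ ⟨e', ⟨he', hk⟩, rfl⟩ hlt
      by_contra! hp
      exact hf' e he e' he' hlt hp hk.symm
    · simp only [K, Finset.mem_image, Finset.mem_filter]
      rintro _ ⟨e, ⟨he, rfl⟩, rfl⟩
      exact e.1.2
  choose α γ hαγ hαγ' using hpot
  refine ⟨fun i k => single (α k i) 1, fun k ℓ => single (γ k ℓ) 1,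
    fun c => single (((c.1 : ℕ) : ℝ) * D c.2) 1, ?_, ?_⟩
  all_goals
    have hsingle : ∀ x : ℝ, addVal ℝ ℂ (single x (1 : ℂ)) = (x : WithTop ℝ) := fun x => by
      rw [addVal_apply, orderTop_single one_ne_zero]
    have hlow : ∀ (i : Fin d) (ℓ : Fin k₂), (w' i ℓ : WithTop ℝ) ≤ addVal ℝ ℂ
        (∑ k ∈ (Finset.range (n + 2)).filter (Allowed n S · ℓ),
          single (α k i) (1 : ℂ) * single (γ k ℓ) 1) := fun i ℓ =>
      AddValuation.map_le_sum _ fun k _ => by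
        rw [AddValuation.map_mul, hsingle, hsingle, ← WithTop.coe_add]
        exact WithTop.coe_le_coe.2 (hαγ k i i.2 ℓ)
  · rintro e
    unfold paramPoint
    split_ifs with hS
    · simp
    · rw [AddValuation.map_mul, hsingle]
      refine le_trans ?_ (add_le_add_right (hlow e.1 e.2.2) _)
      rw [← WithTop.coe_add]
      exact WithTop.coe_le_coe.2 (hle e.1 e.2)
  · intro e he
    unfold paramPoint
    rw [if_neg (hs e he), AddValuation.map_mul, hsingle, ← heq e he, WithTop.coe_add]
    congr 1
    refine le_antisymm (addVal_le_of_coeff_ne_zero ?_) (hlow _ _)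
    simp only [single_mul_single, mul_one, HahnSeries.coeff_sum, coeff_single]
    rw [Finset.sum_boole, Nat.cast_ne_zero, Finset.card_ne_zero]
    refine ⟨f (e.1, e.2.2), ?_⟩
    have hall := hf e he
    simp only [Finset.mem_filter, Finset.mem_range]
    refine ⟨⟨?_, hall⟩, (hαγ' _ _ (Finset.mem_image.2
      ⟨e, Finset.mem_filter.2 ⟨he, rfl⟩, rfl⟩)).symm⟩
    unfold Allowed at hall
    omega

/-- Some element of `G` has a leading monomial dividing `m`, for the weight of the columns
numbered by `colNum S`. -/
def HasInitialDvd {d k₂ : ℕ} (w : ℕ → ℕ → ℝ) (S : Set (Col 2 k₂)) (G : Set (MvP d 2 k₂))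
    (m : Fin d × Col 2 k₂ →₀ ℕ) : Prop :=
  ∃ g ∈ G, ∃ μ ≤ m, g.coeff μ = 1 ∧
    ∀ μ' ∈ g.support, μ'.degree = μ.degree ∧ (μ' ≠ μ →
      Finsupp.weight (fun e : Fin d × Col 2 k₂ => w e.1 (colNum S e.2)) μ <
        Finsupp.weight (fun e : Fin d × Col 2 k₂ => w e.1 (colNum S e.2)) μ')

section Initial

variable {d k₂ : ℕ} {w : ℕ → ℕ → ℝ} {S : Set (Col 2 k₂)} {m : Fin d × Col 2 k₂ →₀ ℕ}

lemma HasInitialDvd.mono {G G' : Set (MvP d 2 k₂)} (h : G ⊆ G') (hG : HasInitialDvd w S G m) :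
    HasInitialDvd w S G' m := by
  obtain ⟨g, hg, h'⟩ := hG
  exact ⟨g, h hg, h'⟩

lemma length_le_of_not_hasInitialDvd
    (hw : ∀ i i' c c', i < i' → c < c' → w i' c + w i c' < w i c + w i' c') {N : ℕ}
    (U : Set (Col 2 k₂)) (hno : ¬ HasInitialDvd w S (minorSet d 2 k₂ (N + 1) U) m)
    (l : List (Fin d × Fin k₂))
    (hl : l.Pairwise fun p q => p.1 < q.1 ∧ pos S q.2 < pos S p.2)
    (hex : ∀ p ∈ l, ∃ s, (p.1, (s, p.2)) ∈ m.support ∧ (s, p.2) ∈ U) : l.length ≤ N := by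
  by_contra! hlen
  choose! s hs hsU using hex
  let p : Fin (N + 1) → Fin d × Fin k₂ := fun k => l.get (Fin.castLE hlen k)
  have hp : ∀ k, p k ∈ l := fun k => l.get_mem _
  have hR : ∀ k k', k < k' → (p k).1 < (p k').1 ∧ pos S (p k').2 < pos S (p k).2 :=
    fun k k' hk => List.pairwise_iff_get.1 hl _ _ hk
  refine hno (exists_minor_initial_le w hw (colNum S) (fun k => (p k).1)
    (fun k => (s (p k), (p k).2)) (fun k k' hk => (hR k k' hk).1) (fun k k' hk => ?_) U
    (fun k => hsU _ (hp k)) m (fun k => hs _ (hp k)))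
  have h1 := (hR k k' hk).2
  have h2 := (s (p k')).2
  simp only [Function.comp, colNum]
  omega

lemma exists_coloring_of_not_hasInitialDvd {n : ℕ}
    (hw : ∀ i i' c c', i < i' → c < c' → w i' c + w i c' < w i c + w i' c')
    (ht : tCond k₂ S) (hno : ¬ HasInitialDvd w S (sumIdeal d k₂ (n + 2) S) m)
    (hmS : ∀ e ∈ m.support, e.2 ∉ S) :
    ∃ f : Fin d × Fin k₂ → ℕ, (∀ e ∈ m.support, Allowed n S (f (e.1, e.2.2)) e.2.2) ∧
      ∀ e ∈ m.support, ∀ e' ∈ m.support, e.1 < e'.1 → pos S e'.2.2 < pos S e.2.2 →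
        f (e.1, e.2.2) ≠ f (e'.1, e'.2.2) := by
  have hIS : (FSset d k₂ (n + 2) S : Set (MvP d 2 k₂)) ⊆ sumIdeal d k₂ (n + 2) S := fun g hg =>
    Ideal.mem_sup_left (Ideal.subset_span hg)
  refine (exists_coloring_of_graded_chain_bounds
    (fun p q : Fin d × Fin k₂ => p.1 < q.1 ∧ pos S q.2 < pos S p.2)
    (fun x y z h h' => ⟨h.1.trans h'.1, h'.2.trans h.2⟩) (fun p => cls S p.2)
    (fun x y h => cls_le_of_pos_lt h.2) (fun x => cls_le_two S x.2) n
    {p | ∃ s, (p.1, (s, p.2)) ∈ m.support} ?_ ?_ ?_ ?_).imp fun f hf =>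
      ⟨fun e he => hf.1 (e.1, e.2.2) ⟨e.2.1, he⟩, fun e he e' he' h1 h2 =>
        hf.2 _ ⟨e.2.1, he⟩ _ ⟨e'.2.1, he'⟩ ⟨h1, h2⟩⟩
  · intro l hl hT hcls
    refine length_le_of_not_hasInitialDvd hw (CSet k₂ S) (fun h => hno (h.mono ?_)) l hl
      fun p hp => ?_
    · exact fun g hg => hIS (Or.inl (Or.inl (Or.inr (Set.mem_iUnion.2 ⟨ht, hg⟩))))
    · obtain ⟨s, hs⟩ := hT p hp
      exact ⟨s, hs, (cls_eq_one_iff S p.2).1 (hcls p hp)⟩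
  · intro l hl hT hcls
    refine length_le_of_not_hasInitialDvd hw (rowSlice 2 k₂ 0 \ S ∪ CSet k₂ S)
      (fun h => hno (h.mono fun g hg => hIS (Or.inl (Or.inr hg)))) l hl fun p hp => ?_
    obtain ⟨s, hs⟩ := hT p hp
    refine ⟨s, hs, ?_⟩
    rcases Nat.le_one_iff_eq_zero_or_eq_one.1 (hcls p hp) with h | h
    · have hS := hmS _ hs
      refine Or.inl ⟨?_, hS⟩
      obtain rfl | rfl : s = 0 ∨ s = 1 := by omega
      · rfl
      · exact absurd (one_mem_of_cls_eq_zero h) hS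
    · exact Or.inr ((cls_eq_one_iff S p.2).1 h)
  · intro l hl hT hcls
    refine length_le_of_not_hasInitialDvd hw (rowSlice 2 k₂ 1 \ S ∪ CSet k₂ S)
      (fun h => hno (h.mono fun g hg => hIS (Or.inr hg))) l hl fun p hp => ?_
    obtain ⟨s, hs⟩ := hT p hp
    refine ⟨s, hs, ?_⟩
    have h1 := hcls p hp
    have h2 := cls_le_two S p.2
    obtain h | h : cls S p.2 = 2 ∨ cls S p.2 = 1 := by omega
    · have hS := hmS _ hs
      refine Or.inl ⟨?_, hS⟩
      obtain rfl | rfl : s = 0 ∨ s = 1 := by omega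
      · exact absurd (zero_mem_of_cls_eq_two h) hS
      · rfl
    · exact Or.inr ((cls_eq_one_iff S p.2).1 h)
  · intro l hl hT
    refine length_le_of_not_hasInitialDvd hw Sᶜ (fun h => hno (h.mono fun g hg =>
      Ideal.mem_sup_right (Ideal.subset_span hg))) l hl fun p hp => ?_
    obtain ⟨s, hs⟩ := hT p hp
    exact ⟨s, hs, hmS _ hs⟩

lemma notMem_of_not_hasInitialDvd {t : ℕ}
    (hw : ∀ i i' c c', i < i' → c < c' → w i' c + w i c' < w i c + w i' c')
    (hno : ¬ HasInitialDvd w S (sumIdeal d k₂ t S) m) :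
    ∀ e ∈ m.support, e.2 ∉ S := by
  intro e he heS
  refine hno (HasInitialDvd.mono (fun g hg => Ideal.mem_sup_left (Ideal.subset_span
    (Or.inl (Or.inl (Or.inl (Or.inl hg)))))) (exists_minor_initial_le w hw (colNum S)
      (r := 1) (fun _ => e.1) (fun _ => e.2) ?_ ?_ S (fun _ => heS) m (fun _ => he)))
  · exact Subsingleton.strictMono _
  · exact Subsingleton.strictAnti _

lemma le_of_not_hasInitialDvd {t : ℕ}
    (hw : ∀ i i' c c', i < i' → c < c' → w i' c + w i c' < w i c + w i' c')
    (hno : ¬ HasInitialDvd w S (sumIdeal d k₂ t S) m) (i i' : Fin d) (ℓ : Fin k₂)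
    (h0 : (i, (0, ℓ)) ∈ m.support) (h1 : (i', (1, ℓ)) ∈ m.support) : i ≤ i' := by
  have hmS := notMem_of_not_hasInitialDvd hw hno
  by_contra! hlt
  have hOK : colOK k₂ S ℓ := Fin.forall_fin_two.2 ⟨hmS _ h0, hmS _ h1⟩
  refine hno (HasInitialDvd.mono (fun g hg => Ideal.mem_sup_left (Ideal.subset_span
    (Or.inl (Or.inl (Or.inl (Or.inr (Set.mem_biUnion hOK hg)))))))
      (exists_minor_initial_le w hw (colNum S) (r := 2) ![i', i] ![(1, ℓ), (0, ℓ)] ?_ ?_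
        (colSlice 2 k₂ ℓ) ?_ m ?_))
  · simpa [Fin.strictMono_iff_lt_succ] using hlt
  · simp [Fin.strictAnti_iff_succ_lt, colNum]
  · simp [Fin.forall_fin_two, colSlice]
  · exact Fin.forall_fin_two.2 ⟨h1, h0⟩

end Initial

lemma weight_colNum_injective {d k₂ : ℕ} (S : Set (Col 2 k₂)) (w : ℕ → ℕ → ℝ)
    (hw : Function.Injective (Finsupp.weight (R := ℕ) fun p : ℕ × ℕ => w p.1 p.2)) :
    Function.Injective
      (Finsupp.weight (R := ℕ) fun e : Fin d × Col 2 k₂ => w e.1 (colNum S e.2)) := by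
  let ι : Fin d × Col 2 k₂ → ℕ × ℕ := fun e => (e.1, colNum S e.2)
  have hι : Function.Injective ι := fun e e' h => Prod.ext (Fin.ext (Prod.ext_iff.1 h).1)
    (colNum_injective S (Prod.ext_iff.1 h).2)
  have hmap : ∀ m : Fin d × Col 2 k₂ →₀ ℕ,
      Finsupp.weight (R := ℕ) (fun p : ℕ × ℕ => w p.1 p.2) (m.mapDomain ι) =
        Finsupp.weight (R := ℕ) (fun e : Fin d × Col 2 k₂ => w e.1 (colNum S e.2)) m := by
    intro m
    rw [Finsupp.weight_apply, Finsupp.weight_apply, Finsupp.sum_mapDomain_index (by simp)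
      (fun _ _ _ => add_smul _ _ _)]
  intro m m' h
  rw [← hmap, ← hmap] at h
  exact Finsupp.mapDomain_injective hι (hw h)

lemma map_paramPoint {R R' : Type*} [CommRing R] [CommRing R'] (θ : R →+* R') {d k₂ n : ℕ}
    (S : Set (Col 2 k₂)) (y : Fin d → ℕ → R) (z : ℕ → Fin k₂ → R) (b : Col 2 k₂ → R)
    (e : Fin d × Col 2 k₂) : θ (paramPoint n S y z b e) =
      paramPoint n S (fun i k => θ (y i k)) (fun k ℓ => θ (z k ℓ)) (fun c => θ (b c)) e := by
  unfold paramPoint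
  split_ifs <;> simp

/-- The polynomial ring in the parameters of `paramPoint`. -/
abbrev ParamRing (d k₂ : ℕ) := MvPolynomial ((Fin d × ℕ) ⊕ (ℕ × Fin k₂) ⊕ Col 2 k₂) ℂ

/-- The pullback of functions along the universal `paramPoint`. -/
def paramHom (d k₂ n : ℕ) (S : Set (Col 2 k₂)) : MvP d 2 k₂ →+* ParamRing d k₂ :=
  eval₂Hom MvPolynomial.C (paramPoint n S (fun i k => X (Sum.inl (i, k)))
    (fun k ℓ => X (Sum.inr (Sum.inl (k, ℓ)))) (fun c => X (Sum.inr (Sum.inr c))))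

lemma sumIdeal_eq_ker_paramHom (d k₂ n : ℕ) (S : Set (Col 2 k₂)) (ht : tCond k₂ S) :
    sumIdeal d k₂ (n + 2) S = RingHom.ker (paramHom d k₂ n S) := by
  have hX := fun e => eval₂Hom_X' (MvPolynomial.C (R := ℂ)) (paramPoint n S
    (fun i k => (X (Sum.inl (i, k)) : ParamRing d k₂))
    (fun k ℓ => X (Sum.inr (Sum.inl (k, ℓ)))) (fun c => X (Sum.inr (Sum.inr c)))) e
  have hle : sumIdeal d k₂ (n + 2) S ≤ RingHom.ker (paramHom d k₂ n S) :=
    map_eq_zero_of_mem_sumIdeal _ hX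
  refine le_antisymm hle ?_
  obtain ⟨w, hw, hinj⟩ := exists_generic_weight
  refine ideal_le_of_exists_initial_dvd
    (Finsupp.weight (R := ℕ) fun e : Fin d × Col 2 k₂ => w e.1 (colNum S e.2))
    (weight_colNum_injective S w hinj) _ _ hle fun f hf m hm hmin => ?_
  by_contra hno
  replace hno : ¬ HasInitialDvd w S (sumIdeal d k₂ (n + 2) S) m := hno
  have hmS := notMem_of_not_hasInitialDvd hw hno
  obtain ⟨c, hc, hc'⟩ := exists_coloring_of_not_hasInitialDvd hw ht hno hmS
  obtain ⟨y, z, b, hge, heq⟩ := exists_paramPoint_addVal w hw m.support hmS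
    (le_of_not_hasInitialDvd hw hno) c hc hc'
  let ψ : ParamRing d k₂ →+* HahnSeries ℝ ℂ := eval₂Hom HahnSeries.C
    (Sum.elim (fun p => y p.1 p.2) (Sum.elim (fun p => z p.1 p.2) b))
  have hψ : ∀ e, (ψ.comp (paramHom d k₂ n S)) (X e) = paramPoint n S y z b e := by
    intro e
    rw [RingHom.comp_apply, paramHom, hX, map_paramPoint]
    simp [ψ]
  refine map_ne_zero_of_addVal (fun e => w e.1 (colNum S e.2)) f m hm hmin
    (ψ.comp (paramHom d k₂ n S)) (fun x => ?_) (fun e => ?_) (fun e he => ?_) ?_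
  · simp [ψ, paramHom]
  · rw [hψ]; exact hge e
  · rw [hψ]; exact heq e he
  · rw [RingHom.comp_apply, RingHom.mem_ker.1 hf, map_zero]

lemma sumIdeal_isPrime {d k₂ t : ℕ} (ht : 2 ≤ t) {S : Set (Col 2 k₂)} (hS : tCond k₂ S) :
    (sumIdeal d k₂ t S).IsPrime := by
  obtain ⟨n, rfl⟩ := Nat.exists_eq_add_of_le' ht
  rw [sumIdeal_eq_ker_paramHom d k₂ n S hS]
  exact RingHom.ker_isPrime _

lemma tCond_of_minimalSubset {k₂ t : ℕ} {S : Set (Col 2 k₂)} (hS : minimalSubset k₂ t S)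
    (hne : S ≠ ∅) : tCond k₂ S := by
  obtain ⟨hcol, hu, -⟩ := hS.resolve_left hne
  have hex : ∀ s : Fin 2, 1 ≤ (rowSlice 2 k₂ s ∩ S).ncard → ∃ ℓ, (s, ℓ) ∈ S := by
    intro s h
    obtain ⟨⟨s', ℓ⟩, rfl, hS⟩ := Set.nonempty_of_ncard_ne_zero (Nat.one_le_iff_ne_zero.1 h)
    exact ⟨ℓ, hS⟩
  have hnot : ∀ ℓ, ¬ ((0, ℓ) ∈ S ∧ (1, ℓ) ∈ S) := by
    rintro ℓ ⟨h0, h1⟩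
    refine hcol ℓ ?_
    rintro ⟨s, ℓ'⟩ rfl
    obtain rfl | rfl : s = 0 ∨ s = 1 := by omega
    · exact h0
    · exact h1
  obtain ⟨ℓ, hℓ⟩ := hex 0 (hu.trans (min_le_left _ _))
  obtain ⟨ℓ', hℓ'⟩ := hex 1 (hu.trans (min_le_right _ _))
  exact ⟨⟨ℓ, hℓ, fun h => hnot ℓ ⟨hℓ, h⟩⟩, ⟨ℓ', hℓ', fun h => hnot ℓ' ⟨h, hℓ'⟩⟩⟩

lemma minorIdeal_eq_bot_of_lt {d k₁ k₂ r : ℕ} (h : d < r) (U : Set (Col k₁ k₂)) :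
    minorIdeal d k₁ k₂ r U = ⊥ := by
  rw [minorIdeal, Ideal.span_eq_bot]
  rintro f ⟨a, -, ha, -⟩
  have := Fintype.card_le_of_injective a ha
  simp only [Fintype.card_fin] at this
  omega

/-- for `k₁ = 2` and `2 ≤ t ≤ min(k₂, d)` and every minimal
nonempty `S ⊆ [2]×[k₂]`, the ideal `I_S + I_{t+1}(X_{([2]×[k₂])∖S})` is prime;
in particular, if `d = t` then `I_S` is prime. -/
theorem ISIdeal_sup_isPrime
    (d k₂ t : ℕ) (ht : 2 ≤ t) (htk : t ≤ k₂) (htd : t ≤ d)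
    (S : Set (Col 2 k₂)) (hS : minimalSubset k₂ t S) (hne : S ≠ ∅) :
    (ISIdeal d k₂ t S ⊔ minorIdeal d 2 k₂ (t + 1) Sᶜ).IsPrime ∧
      (d = t → (ISIdeal d k₂ t S).IsPrime) := by
  have hprime : (sumIdeal d k₂ t S).IsPrime :=
    sumIdeal_isPrime ht (tCond_of_minimalSubset hS hne)
  refine ⟨hprime, ?_⟩
  rintro rfl
  rwa [sumIdeal, minorIdeal_eq_bot_of_lt (Nat.lt_succ_self d), sup_bot_eq] at hprime

end CI
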